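/- Let T > 0 and a, b ≥ 0. Let f : [0, T] → ℝ be integrable with f ≥ 0 almost everywhere, and let g : [0, T] → ℝ be continuous with g ≥ 0 on [0, T]. Suppose that for all s ∈ [0, T], ∫₀ˢ f(t) dt + g(s) ≤ a ∫₀ˢ g(t) dt + b ∫₀ˢ (∫₀ᵗ f(η) dη) dt. Then g(s) = 0 for all s ∈ [0, T] and f = 0 almost everywhere on [0, T]. -/

import Mathlib

open MeasureTheory

/-- **Grönwall's inequality**, integral form with zero initial data: a nonnegative continuous
function dominated by a multiple of its primitive vanishes. -/
theorem ContinuousOn.eq_zero_of_le_mul_integral {φ : ℝ → ℝ} {K a b : ℝ}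
    (hφ : ContinuousOn φ (Set.Icc a b)) (hφ0 : ∀ s ∈ Set.Icc a b, 0 ≤ φ s)
    (hle : ∀ s ∈ Set.Icc a b, φ s ≤ K * ∫ t in a..s, φ t) :
    ∀ s ∈ Set.Icc a b, φ s = 0 := by
  have hint : ∀ s ∈ Set.Icc a b, IntervalIntegrable φ volume a s := fun s hs =>
    (hφ.mono (Set.Icc_subset_Icc_right hs.2)).intervalIntegrable_of_Icc hs.1
  have hcont : ContinuousOn (fun s => ∫ t in a..s, φ t) (Set.Icc a b) := by
    rcases le_or_gt a b with hab | hab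
    · have := intervalIntegral.continuousOn_primitive_interval
        (μ := volume) (f := φ) (a := a) (b := b)
        (by rw [Set.uIcc_of_le hab]; exact hφ.integrableOn_Icc)
      rwa [Set.uIcc_of_le hab] at this
    · simp [Set.Icc_eq_empty hab.not_ge]
  have hzero := eq_zero_of_abs_deriv_le_mul_abs_self_of_eq_zero_right (K := K) hcont
    (f' := φ) (fun x hx => by
      have hx' := Set.Ico_subset_Icc_self hx
      have hmem : Set.Icc a b ∈ nhdsWithin x (Set.Ioi x) :=
        Filter.mem_of_superset (Icc_mem_nhdsGT hx.2) (Set.Icc_subset_Icc_left hx.1)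
      exact intervalIntegral.integral_hasDerivWithinAt_right (hint x hx')
        ((hφ.stronglyMeasurableAtFilter_nhdsWithin measurableSet_Icc x).filter_mono
          (nhdsWithin_le_of_mem hmem)) ((hφ x hx').mono_of_mem_nhdsWithin hmem))
    (by simp)
    (fun x hx => by
      have hx' := Set.Ico_subset_Icc_self hx
      have hI : 0 ≤ ∫ t in a..x, φ t := intervalIntegral.integral_nonneg hx.1
        fun u hu => hφ0 u ⟨hu.1, hu.2.trans hx'.2⟩
      rw [Real.norm_of_nonneg (hφ0 x hx'), Real.norm_of_nonneg hI]
      exact hle x hx')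
  intro s hs
  refine le_antisymm ?_ (hφ0 s hs)
  simpa [hzero s hs] using hle s hs

/-- (Grönwall-type implication.) Let `T > 0`, `a, b ≥ 0`, `f` integrable and
nonnegative a.e. on `[0, T]`, `g` continuous and nonnegative on `[0, T]`. If for all
`s ∈ [0, T]` we have `∫₀ˢ f + g(s) ≤ a ∫₀ˢ g + b ∫₀ˢ (∫₀ᵗ f) dt`, then `g ≡ 0` on `[0, T]`
and `f = 0` a.e. on `[0, T]`. -/
theorem stmt_4 (T : ℝ) (hT : 0 < T) (a b : ℝ) (ha : 0 ≤ a) (hb : 0 ≤ b)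
    (f g : ℝ → ℝ)
    (hf : IntegrableOn f (Set.Icc 0 T))
    (hf0 : ∀ᵐ t ∂(volume.restrict (Set.Icc (0:ℝ) T)), 0 ≤ f t)
    (hg : ContinuousOn g (Set.Icc 0 T))
    (hg0 : ∀ t ∈ Set.Icc (0:ℝ) T, 0 ≤ g t)
    (h : ∀ s ∈ Set.Icc (0:ℝ) T,
      (∫ t in (0:ℝ)..s, f t) + g s ≤
        a * (∫ t in (0:ℝ)..s, g t) + b * ∫ t in (0:ℝ)..s, (∫ η in (0:ℝ)..t, f η)) :
    (∀ s ∈ Set.Icc (0:ℝ) T, g s = 0) ∧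
      (∀ᵐ t ∂(volume.restrict (Set.Icc (0:ℝ) T)), f t = 0) := by
  set F : ℝ → ℝ := fun s => ∫ t in (0:ℝ)..s, f t with hF
  have hFc : ContinuousOn F (Set.Icc 0 T) := by
    have := intervalIntegral.continuousOn_primitive_interval
      (μ := volume) (f := f) (a := 0) (b := T) (by rwa [Set.uIcc_of_le hT.le])
    rwa [Set.uIcc_of_le hT.le] at this
  have hF0 : ∀ s ∈ Set.Icc (0:ℝ) T, 0 ≤ F s := fun s hs =>
    intervalIntegral.integral_nonneg_of_ae_restrict hs.1
      (ae_restrict_of_ae_restrict_of_subset (Set.Icc_subset_Icc_right hs.2) hf0)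
  have hzero := (hFc.add hg).eq_zero_of_le_mul_integral (K := a + b)
    (fun s hs => add_nonneg (hF0 s hs) (hg0 s hs)) (fun s hs => by
      have hsub : Set.Icc 0 s ⊆ Set.Icc 0 T := Set.Icc_subset_Icc_right hs.2
      have hgI : 0 ≤ ∫ t in (0:ℝ)..s, g t :=
        intervalIntegral.integral_nonneg hs.1 fun u hu => hg0 u (hsub hu)
      have hFI : 0 ≤ ∫ t in (0:ℝ)..s, F t :=
        intervalIntegral.integral_nonneg hs.1 fun u hu => hF0 u (hsub hu)
      have hadd : ∫ t in (0:ℝ)..s, (F + g) t = (∫ t in (0:ℝ)..s, F t) + ∫ t in (0:ℝ)..s, g t :=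
        intervalIntegral.integral_add ((hFc.mono hsub).intervalIntegrable_of_Icc hs.1)
          ((hg.mono hsub).intervalIntegrable_of_Icc hs.1)
      have hs' : F s + g s ≤ a * (∫ t in (0:ℝ)..s, g t) + b * ∫ t in (0:ℝ)..s, F t := h s hs
      rw [hadd, Pi.add_apply]
      nlinarith [mul_nonneg ha hFI, mul_nonneg hb hgI])
  have hboth : ∀ s ∈ Set.Icc (0:ℝ) T, F s = 0 ∧ g s = 0 := fun s hs =>
    (add_eq_zero_iff_of_nonneg (hF0 s hs) (hg0 s hs)).1 (hzero s hs)
  refine ⟨fun s hs => (hboth s hs).2, ?_⟩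
  have hFT : ∫ t in Set.Icc 0 T, f t = 0 := by
    rw [integral_Icc_eq_integral_Ioc, ← intervalIntegral.integral_of_le hT.le]
    exact (hboth T (Set.right_mem_Icc.2 hT.le)).1
  exact (setIntegral_eq_zero_iff_of_nonneg_ae hf0 hf).1 hFT
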